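/- Let {a_n, b_n, ⟨,⟩_n, r^n_m, c^n_m} be a collection of data satisfying axioms (Γ-1)–(Γ-4) of a Γ-system. Let a⁰_n = ker(a_n → lim→ a_m) (direct limit along r^n_m) and let b¹_n ⊆ b_n be the annihilator of a⁰_n under ⟨,⟩_n. Then the b¹_n are stable under the transition maps c^n_m, and the map lim← b¹_n → lim← b_n (inverse limits along c^n_m) induced by the inclusions b¹_n ⊆ b_n is an isomorphism; equivalently, every compatible family (y_n)_n ∈ lim← b_n satisfies y_n ∈ b¹_n for all n. -/

import Mathlib

open scoped BigOperators

noncomputable section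

/-- The group `ℚ_p/ℤ_p`, realized as the quotient of the additive group of `ℚ_p`
by the image of `ℤ_p`. -/
abbrev QpZp (p : ℕ) [Fact p.Prime] : Type :=
  ℚ_[p] ⧸ ((PadicInt.Coe.ringHom (p := p)).toAddMonoidHom.range)

/-- The subgroup of `k`-th powers of a commutative group `Γ`. -/
def powSubgroup (Γ : Type) [CommGroup Γ] (k : ℕ) : Subgroup Γ :=
  (powMonoidHom k : Γ →* Γ).range

/-- A collection of data satisfying the axioms (Γ-1)–(Γ-4) of a `Γ`-system in the sense of
Lai–Longhi–Tan–Trihan: finite `ℤ_p`-modules `a n`, `b n` with `Γ`-actions on which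
`Γ^{p^n}` acts trivially, transition maps `r`, `c` forming inductive/projective systems,
the norm relations, and perfect `Γ`-compatible pairings into `ℚ_p/ℤ_p`. -/
structure GammaSystem (p : ℕ) [Fact p.Prime] (d : ℕ) : Type 1 where
  Γ : Type
  [instΓ : CommGroup Γ]
  gammaIso : Γ ≃* Multiplicative (Fin d → ℤ_[p])
  a : ℕ → Type
  b : ℕ → Type
  [instA : ∀ n, AddCommGroup (a n)]
  [instB : ∀ n, AddCommGroup (b n)]
  [modA : ∀ n, Module ℤ_[p] (a n)]
  [modB : ∀ n, Module ℤ_[p] (b n)]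
  finA : ∀ n, Finite (a n)
  finB : ∀ n, Finite (b n)
  /-- the `Γ`-action on `a n`, by `ℤ_p`-linear automorphisms -/
  ρa : ∀ n, Γ →* (a n ≃ₗ[ℤ_[p]] a n)
  ρb : ∀ n, Γ →* (b n ≃ₗ[ℤ_[p]] b n)
  /-- (Γ-1): `Γ^{p^n}` acts trivially on `a n` -/
  triv_a : ∀ n : ℕ, ∀ γ ∈ powSubgroup Γ (p ^ n), ρa n γ = 1
  triv_b : ∀ n : ℕ, ∀ γ ∈ powSubgroup Γ (p ^ n), ρb n γ = 1
  /-- the maps `r^n_m` (on the `a`-component) -/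
  ra : ∀ {m n : ℕ}, m ≤ n → a m →ₗ[ℤ_[p]] a n
  rb : ∀ {m n : ℕ}, m ≤ n → b m →ₗ[ℤ_[p]] b n
  /-- the maps `c^n_m` (on the `a`-component) -/
  ca : ∀ {m n : ℕ}, m ≤ n → a n →ₗ[ℤ_[p]] a m
  cb : ∀ {m n : ℕ}, m ≤ n → b n →ₗ[ℤ_[p]] b m
  ra_refl : ∀ (n : ℕ) (x : a n), ra (le_refl n) x = x
  rb_refl : ∀ (n : ℕ) (x : b n), rb (le_refl n) x = x
  ca_refl : ∀ (n : ℕ) (x : a n), ca (le_refl n) x = x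
  cb_refl : ∀ (n : ℕ) (x : b n), cb (le_refl n) x = x
  /-- (Γ-2): the `r`'s form an inductive system -/
  ra_trans : ∀ {k m n : ℕ} (h₁ : k ≤ m) (h₂ : m ≤ n) (x : a k),
    ra h₂ (ra h₁ x) = ra (h₁.trans h₂) x
  rb_trans : ∀ {k m n : ℕ} (h₁ : k ≤ m) (h₂ : m ≤ n) (x : b k),
    rb h₂ (rb h₁ x) = rb (h₁.trans h₂) x
  /-- (Γ-2): the `c`'s form a projective system -/
  ca_trans : ∀ {k m n : ℕ} (h₁ : k ≤ m) (h₂ : m ≤ n) (x : a n),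
    ca h₁ (ca h₂ x) = ca (h₁.trans h₂) x
  cb_trans : ∀ {k m n : ℕ} (h₁ : k ≤ m) (h₂ : m ≤ n) (x : b n),
    cb h₁ (cb h₂ x) = cb (h₁.trans h₂) x
  /-- (Γ-2): the transition maps are `Γ`-equivariant -/
  ra_comm : ∀ {m n : ℕ} (h : m ≤ n) (γ : Γ) (x : a m), ra h (ρa m γ x) = ρa n γ (ra h x)
  rb_comm : ∀ {m n : ℕ} (h : m ≤ n) (γ : Γ) (x : b m), rb h (ρb m γ x) = ρb n γ (rb h x)
  ca_comm : ∀ {m n : ℕ} (h : m ≤ n) (γ : Γ) (x : a n), ca h (ρa n γ x) = ρa m γ (ca h x)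
  cb_comm : ∀ {m n : ℕ} (h : m ≤ n) (γ : Γ) (x : b n), cb h (ρb n γ x) = ρb m γ (cb h x)
  /-- (Γ-3): `r^n_m ∘ c^n_m` is the norm map `Σ_{γ ∈ Γ^{p^m}/Γ^{p^n}} γ`, expressed via a
  complete set `T` of representatives of the cosets of `Γ^{p^n}` in `Γ^{p^m}` -/
  norm_a : ∀ {m n : ℕ} (h : m ≤ n), ∃ T : Finset Γ,
    (∀ γ ∈ T, γ ∈ powSubgroup Γ (p ^ m)) ∧
    (∀ γ ∈ powSubgroup Γ (p ^ m), ∃! s, s ∈ T ∧ s⁻¹ * γ ∈ powSubgroup Γ (p ^ n)) ∧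
    (∀ x : a n, ra h (ca h x) = ∑ γ ∈ T, ρa n γ x)
  norm_b : ∀ {m n : ℕ} (h : m ≤ n), ∃ T : Finset Γ,
    (∀ γ ∈ T, γ ∈ powSubgroup Γ (p ^ m)) ∧
    (∀ γ ∈ powSubgroup Γ (p ^ m), ∃! s, s ∈ T ∧ s⁻¹ * γ ∈ powSubgroup Γ (p ^ n)) ∧
    (∀ y : b n, rb h (cb h y) = ∑ γ ∈ T, ρb n γ y)
  /-- (Γ-3): `c^n_m ∘ r^n_m` is multiplication by `p^{n-m}` -/
  cr_a : ∀ {m n : ℕ} (h : m ≤ n) (x : a m), ca h (ra h x) = (p ^ (n - m)) • x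
  cr_b : ∀ {m n : ℕ} (h : m ≤ n) (y : b m), cb h (rb h y) = (p ^ (n - m)) • y
  /-- (Γ-4): the pairings `⟨,⟩_n` -/
  pair : ∀ n, a n →+ (b n →+ QpZp p)
  /-- (Γ-4): perfectness: `a n → Hom(b n, ℚ_p/ℤ_p)` is bijective -/
  perfect_a : ∀ n, Function.Bijective (pair n)
  /-- (Γ-4): perfectness: `b n → Hom(a n, ℚ_p/ℤ_p)` is bijective -/
  perfect_b : ∀ n, Function.Bijective (pair n).flip
  /-- (Γ-4): `Γ`-invariance of the pairings -/
  pair_inv : ∀ (n : ℕ) (γ : Γ) (x : a n) (y : b n), pair n (ρa n γ x) (ρb n γ y) = pair n x y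
  /-- (Γ-4): adjunction `⟨a_n, r(b_m)⟩_n = ⟨c(a_n), b_m⟩_m` -/
  pair_rc : ∀ {m n : ℕ} (h : m ≤ n) (x : a n) (y : b m), pair n x (rb h y) = pair m (ca h x) y
  /-- (Γ-4): adjunction `⟨r(a_m), b_n⟩_n = ⟨a_m, c(b_n)⟩_m` -/
  pair_cr : ∀ {m n : ℕ} (h : m ≤ n) (x : a m) (y : b n), pair n (ra h x) y = pair m x (cb h y)

attribute [instance] GammaSystem.instΓ GammaSystem.instA GammaSystem.instB
  GammaSystem.modA GammaSystem.modB

namespace GammaSystem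

variable {p d : ℕ} [Fact p.Prime] (S : GammaSystem p d)

/-- `a⁰_n`: the kernel of the canonical map `a n → lim→ a m` (elementwise: those `x` killed
by some transition map `r`). -/
def A0 (n : ℕ) : Submodule ℤ_[p] (S.a n) where
  carrier := {x | ∃ k, ∃ h : n ≤ k, S.ra h x = 0}
  zero_mem' := ⟨n, le_refl n, map_zero _⟩
  add_mem' := by
    rintro x y ⟨k₁, h₁, e₁⟩ ⟨k₂, h₂, e₂⟩
    refine ⟨max k₁ k₂, h₁.trans (le_max_left k₁ k₂), ?_⟩
    have ex : S.ra (h₁.trans (le_max_left k₁ k₂)) x = 0 := by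
      rw [← S.ra_trans h₁ (le_max_left k₁ k₂), e₁, map_zero]
    have ey : S.ra (h₁.trans (le_max_left k₁ k₂)) y = 0 := by
      have h' := S.ra_trans h₂ (le_max_right k₁ k₂) y
      rw [e₂, map_zero] at h'
      exact h'.symm
    rw [map_add, ex, ey, add_zero]
  smul_mem' := by
    rintro c x ⟨k, h, e⟩
    exact ⟨k, h, by rw [map_smul, e, smul_zero]⟩

/-- `b⁰_n`: the kernel of the canonical map `b n → lim→ b m`. -/
def B0 (n : ℕ) : Submodule ℤ_[p] (S.b n) where
  carrier := {y | ∃ k, ∃ h : n ≤ k, S.rb h y = 0}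
  zero_mem' := ⟨n, le_refl n, map_zero _⟩
  add_mem' := by
    rintro x y ⟨k₁, h₁, e₁⟩ ⟨k₂, h₂, e₂⟩
    refine ⟨max k₁ k₂, h₁.trans (le_max_left k₁ k₂), ?_⟩
    have ex : S.rb (h₁.trans (le_max_left k₁ k₂)) x = 0 := by
      rw [← S.rb_trans h₁ (le_max_left k₁ k₂), e₁, map_zero]
    have ey : S.rb (h₁.trans (le_max_left k₁ k₂)) y = 0 := by
      have h' := S.rb_trans h₂ (le_max_right k₁ k₂) y
      rw [e₂, map_zero] at h'
      exact h'.symm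
    rw [map_add, ex, ey, add_zero]
  smul_mem' := by
    rintro c x ⟨k, h, e⟩
    exact ⟨k, h, by rw [map_smul, e, smul_zero]⟩

/-- `a¹_n`: the annihilator of `b⁰_n` in `a n` under the pairing `⟨,⟩_n`. -/
def A1 (n : ℕ) : AddSubgroup (S.a n) where
  carrier := {x | ∀ y ∈ S.B0 n, S.pair n x y = 0}
  zero_mem' := fun y _ => by simp
  add_mem' := by
    intro x₁ x₂ h₁ h₂ y hy
    rw [map_add, AddMonoidHom.add_apply, h₁ y hy, h₂ y hy, add_zero]
  neg_mem' := by
    intro x hx y hy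
    rw [map_neg, AddMonoidHom.neg_apply, hx y hy, neg_zero]

/-- `b¹_n`: the annihilator of `a⁰_n` in `b n` under the pairing `⟨,⟩_n`. -/
def B1 (n : ℕ) : AddSubgroup (S.b n) where
  carrier := {y | ∀ x ∈ S.A0 n, S.pair n x y = 0}
  zero_mem' := fun x _ => by simp
  add_mem' := by
    intro y₁ y₂ h₁ h₂ x hx
    rw [map_add, h₁ x hx, h₂ x hx, add_zero]
  neg_mem' := by
    intro y hy x hx
    rw [map_neg, hy x hx, neg_zero]

/-- `a := lim← a_n`, the inverse limit along the maps `c^n_m`. -/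
def invLimA : AddSubgroup (∀ n, S.a n) where
  carrier := {x | ∀ (m n : ℕ) (h : m ≤ n), S.ca h (x n) = x m}
  zero_mem' := fun m n h => by simp
  add_mem' := by
    intro x y hx hy m n h
    simp only [Pi.add_apply, map_add, hx m n h, hy m n h]
  neg_mem' := by
    intro x hx m n h
    simp only [Pi.neg_apply, map_neg, hx m n h]

/-- `b := lim← b_n`, the inverse limit along the maps `c^n_m`. -/
def invLimB : AddSubgroup (∀ n, S.b n) where
  carrier := {y | ∀ (m n : ℕ) (h : m ≤ n), S.cb h (y n) = y m}
  zero_mem' := fun m n h => by simp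
  add_mem' := by
    intro x y hx hy m n h
    simp only [Pi.add_apply, map_add, hx m n h, hy m n h]
  neg_mem' := by
    intro x hx m n h
    simp only [Pi.neg_apply, map_neg, hx m n h]

end GammaSystem

namespace GammaSystem

variable {p d : ℕ} [Fact p.Prime] (S : GammaSystem p d)

/-- `b¹ := lim← b¹_n`, realized as the subgroup of `lim← b_n` consisting of families
lying in `b¹_n` at every level. -/
def invLimB1 : AddSubgroup (∀ n, S.b n) where
  carrier := {y | (∀ n, y n ∈ S.B1 n) ∧ ∀ (m n : ℕ) (h : m ≤ n), S.cb h (y n) = y m}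
  zero_mem' := ⟨fun n => (S.B1 n).zero_mem, fun m n h => by simp⟩
  add_mem' := by
    rintro x y ⟨hx1, hx2⟩ ⟨hy1, hy2⟩
    exact ⟨fun n => (S.B1 n).add_mem (hx1 n) (hy1 n),
      fun m n h => by simp only [Pi.add_apply, map_add, hx2 m n h, hy2 m n h]⟩
  neg_mem' := by
    rintro x ⟨hx1, hx2⟩
    exact ⟨fun n => (S.B1 n).neg_mem (hx1 n),
      fun m n h => by simp only [Pi.neg_apply, map_neg, hx2 m n h]⟩

end GammaSystem

namespace GammaSystem

variable {p d : ℕ} [Fact p.Prime] (S : GammaSystem p d)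

theorem ra_mem_A0 {m n : ℕ} (h : m ≤ n) {x : S.a m} (hx : x ∈ S.A0 m) :
    S.ra h x ∈ S.A0 n := by
  obtain ⟨k, hk, e⟩ := hx
  refine ⟨max k n, le_max_right k n, ?_⟩
  rw [S.ra_trans, ← S.ra_trans hk (le_max_left k n), e, map_zero]

theorem mem_B1_of_mem_invLimB {y : ∀ n, S.b n} (hy : y ∈ S.invLimB) (n : ℕ) :
    y n ∈ S.B1 n := by
  rintro x ⟨k, hk, e⟩
  rw [← hy n k hk, ← S.pair_cr hk, e, map_zero, AddMonoidHom.zero_apply]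

end GammaSystem

/-- For a `Γ`-system, the annihilators `b¹_n` of `a⁰_n` are stable under the
transition maps `c^n_m`, and the natural map `lim← b¹_n → lim← b_n` induced by the inclusions
`b¹_n ⊆ b_n` is an isomorphism; equivalently, every compatible family `(y_n)_n ∈ lim← b_n`
satisfies `y_n ∈ b¹_n` for all `n`. -/
theorem gammaSystem_invLimB1_eq_invLimB (p d : ℕ) [Fact p.Prime]
    (hp : p.Prime) (hodd : Odd p) (hd : 1 ≤ d) (S : GammaSystem p d) :
    (∀ (m n : ℕ) (h : m ≤ n), ∀ y ∈ S.B1 n, S.cb h y ∈ S.B1 m) ∧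
      S.invLimB1 = S.invLimB := by
  refine ⟨fun m n h y hy x hx => ?_, ?_⟩
  · rw [← S.pair_cr h]
    exact hy _ (S.ra_mem_A0 h hx)
  · ext y
    exact ⟨fun hy => hy.2, fun hy => ⟨fun n => S.mem_B1_of_mem_invLimB hy n, hy⟩⟩
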